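/- Let A ∈ ℝ^{N×N} be symmetric positive semidefinite with largest eigenvalue at most 2, let C ∈ ℝ^{n×N} satisfy C Cᵀ = I_n, let k ≤ n, let U_k ∈ ℝ^{N×k} have as columns orthonormal eigenvectors of A for its k smallest eigenvalues λ(1) ≤ … ≤ λ(k), and set δ = ‖(I_N − CᵀC) U_k‖_F². If δ < 1, then the k smallest eigenvalues λ_c(1) ≤ … ≤ λ_c(k) of C A Cᵀ satisfy Σ_{i=1}^k (λ_c(i) − λ(i)) ≤ (δ·(2 + Σ_{i=1}^k λ(i)) + √(8 δ Σ_{i=1}^k λ(i))) / (1 − δ). -/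

import Mathlib

open Matrix BigOperators

noncomputable section

/-- Degree of node `i`: the `i`-th row sum of the weight matrix. -/
def deg {N : ℕ} (W : Matrix (Fin N) (Fin N) ℝ) (i : Fin N) : ℝ := ∑ j, W i j

/-- `D^{-1/2}`: the diagonal matrix of inverse square roots of degrees. -/
def invSqrtDeg {N : ℕ} (W : Matrix (Fin N) (Fin N) ℝ) : Matrix (Fin N) (Fin N) ℝ :=
  Matrix.diagonal fun i => (Real.sqrt (deg W i))⁻¹

/-- Normalized Laplacian `L = I - D^{-1/2} W D^{-1/2}`. -/
def normLap {N : ℕ} (W : Matrix (Fin N) (Fin N) ℝ) : Matrix (Fin N) (Fin N) ℝ :=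
  1 - invSqrtDeg W * W * invSqrtDeg W

/-- Random-walk transition matrix `D^{-1} W`. -/
def rwMat {N : ℕ} (W : Matrix (Fin N) (Fin N) ℝ) : Matrix (Fin N) (Fin N) ℝ :=
  Matrix.diagonal (fun i => (deg W i)⁻¹) * W

/-- The 0/1 partition matrix `P` of the partition encoded by `f` (node `i` lies in part `f i`). -/
def partMat {N n : ℕ} (f : Fin N → Fin n) : Matrix (Fin n) (Fin N) ℝ :=
  fun p i => if f i = p then 1 else 0

/-- Size `|S_p|` of the part `p`. -/
def partSize {N n : ℕ} (f : Fin N → Fin n) (p : Fin n) : ℕ :=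
  (Finset.univ.filter fun i => f i = p).card

/-- Coarse adjacency matrix `W_c = P W Pᵀ`. -/
def coarse {N n : ℕ} (f : Fin N → Fin n) (W : Matrix (Fin N) (Fin N) ℝ) :
    Matrix (Fin n) (Fin n) ℝ :=
  partMat f * W * (partMat f)ᵀ

/-- Lifted adjacency matrix `W_l(i,j) = W_c(f i, f j) / (|S_{f i}|·|S_{f j}|)`. -/
def liftG {N n : ℕ} (f : Fin N → Fin n) (W : Matrix (Fin N) (Fin N) ℝ) :
    Matrix (Fin N) (Fin N) ℝ :=
  fun i j => coarse f W (f i) (f j) / ((partSize f (f i) : ℝ) * (partSize f (f j) : ℝ))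

/-- Normalized coarsening matrix `C` with `C(p,i) = 1/√|S_p|` iff `i ∈ S_p`. -/
def coarsenMat {N n : ℕ} (f : Fin N → Fin n) : Matrix (Fin n) (Fin N) ℝ :=
  fun p i => if f i = p then (Real.sqrt (partSize f p : ℝ))⁻¹ else 0

/-- Pseudo-inverse `P⁺` of the partition matrix, `P⁺(i,p) = 1/|S_p|` iff `i ∈ S_p`. -/
def pinvMat {N n : ℕ} (f : Fin N → Fin n) : Matrix (Fin N) (Fin n) ℝ :=
  fun i p => if f i = p then ((partSize f p : ℝ))⁻¹ else 0

/-- `μ` lists the eigenvalues of `A` in nondecreasing order (with multiplicity):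
`μ` is monotone and the characteristic polynomial of `A` splits as `∏ (X - μ i)`. -/
def sortedEigs {m : ℕ} (A : Matrix (Fin m) (Fin m) ℝ) (μ : Fin m → ℝ) : Prop :=
  Monotone μ ∧ A.charpoly = ∏ i, (Polynomial.X - Polynomial.C (μ i))

/-- Squared Frobenius norm of a matrix. -/
def frobSq {a b : ℕ} (M : Matrix (Fin a) (Fin b) ℝ) : ℝ := ∑ i, ∑ j, (M i j) ^ 2

/-- Partial spectral distance between sorted spectra `μ` (original, size `N`) and
`μc` (coarse, size `n`): `∑_{i=1}^k |μ(i) - μc(i)| + ∑_{i=k+1}^n |μc(i) - μ(i+N-n)|`,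
where `k` is the largest index with `μc k < 1` (for monotone `μc`). -/
def SDpart {N n : ℕ} (h : n ≤ N) (μ : Fin N → ℝ) (μc : Fin n → ℝ) : ℝ :=
  ∑ i : Fin n,
    if μc i < 1 then |μ (Fin.castLE h i) - μc i|
    else |μc i - μ ⟨i.1 + N - n, by have := i.2; omega⟩|

/-- Weighted Ky Fan inequality for a nonnegative monotone sequence and weights in `[0, 1]` of total
mass at most `k`. -/
lemma sum_head_le_sum_weighted {n k : ℕ} (hk : k ≤ n) {ν : Fin n → ℝ} (hν : Monotone ν)
    (hν0 : ∀ j, 0 ≤ ν j) {w : Fin n → ℝ} (hw0 : ∀ j, 0 ≤ w j) (hw1 : ∀ j, w j ≤ 1)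
    (hw : ∑ j, w j ≤ k) :
    ∑ i : Fin k, ν (Fin.castLE hk i) ≤
      ∑ j, ν j * w j + (k - ∑ j, w j) * ∑ i : Fin k, ν (Fin.castLE hk i) := by
  obtain ⟨m, rfl⟩ := Nat.exists_eq_add_of_le hk
  have hcast : ∀ i : Fin k, Fin.castLE hk i = Fin.castAdd m i := fun _ => rfl
  simp only [hcast]
  rw [Fin.sum_univ_add] at hw ⊢
  rw [Fin.sum_univ_add (f := w)]
  obtain _ | p := k
  · simp only [Finset.univ_eq_empty, Finset.sum_empty, mul_zero, add_zero, zero_add]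
    exact Finset.sum_nonneg fun j _ => mul_nonneg (hν0 _) (hw0 _)
  set t := ν (Fin.castAdd m (Fin.last p)) with ht
  have hhead : ∑ i : Fin (p + 1), (ν (Fin.castAdd m i) - ν (Fin.castAdd m i) * w (Fin.castAdd m i))
      ≤ ∑ i : Fin (p + 1), t * (1 - w (Fin.castAdd m i)) := by
    refine Finset.sum_le_sum fun i _ => ?_
    have h : ν (Fin.castAdd m i) ≤ t := hν (Fin.le_def.2 (Nat.lt_succ_iff.1 i.2))
    nlinarith [hw1 (Fin.castAdd m i)]
  have htail : ∑ j : Fin m, t * w (Fin.natAdd (p + 1) j) ≤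
      ∑ j : Fin m, ν (Fin.natAdd (p + 1) j) * w (Fin.natAdd (p + 1) j) := by
    refine Finset.sum_le_sum fun j _ => mul_le_mul_of_nonneg_right (hν ?_) (hw0 _)
    rw [Fin.le_def]
    simp only [Fin.val_castAdd, Fin.val_last, Fin.val_natAdd]
    omega
  have htop : t ≤ ∑ i : Fin (p + 1), ν (Fin.castAdd m i) :=
    Finset.single_le_sum (f := fun i : Fin (p + 1) => ν (Fin.castAdd m i))
      (fun i _ => hν0 _) (Finset.mem_univ (Fin.last p))
  simp only [← Finset.mul_sum, Finset.sum_sub_distrib, Finset.sum_const, Finset.card_univ,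
    Fintype.card_fin, nsmul_eq_mul, mul_one] at hhead htail
  nlinarith [mul_le_mul_of_nonneg_left htop (sub_nonneg.2 hw)]

/-- Partial sums over an initial segment of `Fin n` of a nonnegative function. -/
lemma sum_castLE_le_sum {n k : ℕ} (hk : k ≤ n) {f : Fin n → ℝ} (hf : ∀ j, 0 ≤ f j) :
    ∑ i : Fin k, f (Fin.castLE hk i) ≤ ∑ j, f j := by
  calc ∑ i : Fin k, f (Fin.castLE hk i) = ∑ j ∈ Finset.univ.map (Fin.castLEEmb hk), f j := by
        simp
    _ ≤ ∑ j, f j := Finset.sum_le_univ_sum_of_nonneg hf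

/-- Two monotone enumerations of the same multiset agree. -/
lemma monotone_eq_of_map_eq {n : ℕ} {f g : Fin n → ℝ} (hf : Monotone f) (hg : Monotone g)
    (h : Finset.univ.val.map f = Finset.univ.val.map g) : f = g := by
  rw [Fin.univ_val_map, Fin.univ_val_map, Multiset.coe_eq_coe] at h
  exact List.ofFn_injective (h.eq_of_sortedLE hf.sortedLE_ofFn hg.sortedLE_ofFn)

/-- A symmetric matrix is orthogonally diagonalized by its sorted eigenvalues. -/
lemma exists_orthogonal_diagonalization {n : ℕ} {B : Matrix (Fin n) (Fin n) ℝ}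
    (hB : B.IsHermitian) {ν : Fin n → ℝ} (hν : sortedEigs B ν) :
    ∃ Q : Matrix (Fin n) (Fin n) ℝ, Qᵀ * Q = 1 ∧ Qᵀ * B * Q = diagonal ν := by
  obtain ⟨hmono, hchar⟩ := hν
  set σ := Tuple.sort hB.eigenvalues
  have hroots : Finset.univ.val.map hB.eigenvalues = Finset.univ.val.map ν := by
    have h1 := hB.roots_charpoly_eq_eigenvalues
    rw [hchar, Polynomial.roots_prod _ _
      (Finset.prod_ne_zero_iff.2 fun i _ => Polynomial.X_sub_C_ne_zero _)] at h1
    simpa using h1.symm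
  have hσ : hB.eigenvalues ∘ σ = ν := by
    refine monotone_eq_of_map_eq (Tuple.monotone_sort _) hmono ?_
    rw [← hroots, ← Multiset.map_map]
    simp
  let E : Matrix (Fin n) (Fin n) ℝ := hB.eigenvectorUnitary
  have hE : Eᵀ * E = 1 := by
    have := Unitary.coe_star_mul_self hB.eigenvectorUnitary
    rwa [star_eq_conjTranspose, conjTranspose_eq_transpose_of_trivial] at this
  have hspec : B = E * diagonal hB.eigenvalues * Eᵀ := by
    have := hB.spectral_theorem
    rwa [Unitary.conjStarAlgAut_apply, star_eq_conjTranspose,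
      conjTranspose_eq_transpose_of_trivial] at this
  have hdiag : Eᵀ * B * E = diagonal hB.eigenvalues := by
    calc Eᵀ * B * E = Eᵀ * (E * diagonal hB.eigenvalues * Eᵀ) * E := by rw [← hspec]
      _ = (Eᵀ * E) * diagonal hB.eigenvalues * (Eᵀ * E) := by simp only [Matrix.mul_assoc]
      _ = diagonal hB.eigenvalues := by rw [hE, Matrix.one_mul, Matrix.mul_one]
  refine ⟨E.submatrix id σ, ?_, ?_⟩
  · have : (E.submatrix id σ)ᵀ * E.submatrix id σ = (Eᵀ * E).submatrix σ σ := rfl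
    rw [this, hE, submatrix_one_equiv]
  · have : (E.submatrix id σ)ᵀ * B * E.submatrix id σ = (Eᵀ * B * E).submatrix σ σ := rfl
    rw [this, hdiag, submatrix_diagonal_equiv, hσ]

/-- Diagonal entries of `Tᵀ D T` for a diagonal matrix `D`. -/
lemma transpose_mul_diagonal_mul_apply_self {m n : ℕ} (T : Matrix (Fin m) (Fin n) ℝ)
    (d : Fin m → ℝ) (i : Fin n) : (Tᵀ * diagonal d * T) i i = ∑ j, d j * T j i ^ 2 := by
  rw [Matrix.mul_apply]
  refine Finset.sum_congr rfl fun j _ => ?_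
  rw [Matrix.mul_diagonal, transpose_apply]
  ring

lemma transpose_mul_apply_self {m n : ℕ} (T : Matrix (Fin m) (Fin n) ℝ) (i : Fin n) :
    (Tᵀ * T) i i = ∑ j, T j i ^ 2 := by
  simp only [Matrix.mul_apply, transpose_apply, sq]

/-- If an orthogonal projection `G` compresses a diagonal matrix with entries in `[0, 2]`, its
`i`-th diagonal entry grows by at most `2 (1 - G i i)`. -/
lemma sum_mul_projection_sq_le {N : ℕ} {G : Matrix (Fin N) (Fin N) ℝ} (hsymm : Gᵀ = G)
    (hidem : G * G = G) {μ : Fin N → ℝ} (hμ0 : ∀ l, 0 ≤ μ l) (hμ2 : ∀ l, μ l ≤ 2) (i : Fin N) :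
    (G * diagonal μ * G) i i ≤ μ i + 2 * (1 - G i i) := by
  have hsq : ∑ l, G l i ^ 2 = G i i := by
    rw [← transpose_mul_apply_self, hsymm, hidem]
  have hle : G i i ^ 2 ≤ G i i := by
    conv_rhs => rw [← hsq]
    exact Finset.single_le_sum (f := fun l => G l i ^ 2) (fun l _ => sq_nonneg _)
      (Finset.mem_univ i)
  calc (G * diagonal μ * G) i i = ∑ l, μ l * G l i ^ 2 := by
        rw [← transpose_mul_diagonal_mul_apply_self, hsymm]
    _ ≤ ∑ l, (2 * G l i ^ 2 + if l = i then μ i + 2 - 4 * G i i else 0) := by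
        refine Finset.sum_le_sum fun l _ => ?_
        split_ifs with h
        · subst h
          nlinarith [hμ0 l, hμ2 l, sq_nonneg (G l l - 1)]
        · nlinarith [hμ2 l, sq_nonneg (G l i)]
    _ = μ i + 2 * (1 - G i i) := by
        rw [Finset.sum_add_distrib, ← Finset.mul_sum, hsq,
          Finset.sum_ite_eq' Finset.univ i, if_pos (Finset.mem_univ i)]
        ring

/-- Head eigenvalue comparison for a coisometry `T` that compresses `diagonal μ` to
`diagonal ν`. -/
lemma sum_head_compression_le {N n k : ℕ} (hk : k ≤ n) (hkN : k ≤ N)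
    {T : Matrix (Fin n) (Fin N) ℝ} (hT : T * Tᵀ = 1) {μ : Fin N → ℝ} (hμ0 : ∀ l, 0 ≤ μ l)
    (hμ2 : ∀ l, μ l ≤ 2) {ν : Fin n → ℝ} (hν : Monotone ν)
    (hcomp : T * diagonal μ * Tᵀ = diagonal ν) {δ : ℝ} (hδ0 : 0 ≤ δ)
    (hδ : δ = ∑ i : Fin k, (1 - (Tᵀ * T) (Fin.castLE hkN i) (Fin.castLE hkN i))) :
    (1 - δ) * ∑ i : Fin k, ν (Fin.castLE hk i) ≤
      ∑ i : Fin k, μ (Fin.castLE hkN i) + 2 * δ := by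
  have hν0 : ∀ j, 0 ≤ ν j := fun j => by
    have h := transpose_mul_diagonal_mul_apply_self Tᵀ μ j
    rw [transpose_transpose, hcomp, diagonal_apply_eq] at h
    rw [h]
    exact Finset.sum_nonneg fun l _ => mul_nonneg (hμ0 l) (sq_nonneg _)
  set w : Fin n → ℝ := fun j => ∑ i : Fin k, T j (Fin.castLE hkN i) ^ 2 with hw
  have hw1 : ∀ j, w j ≤ 1 := fun j => by
    have h := transpose_mul_apply_self Tᵀ j
    rw [transpose_transpose, hT, one_apply_eq] at h
    rw [h]
    exact sum_castLE_le_sum hkN (f := fun l => T j l ^ 2) fun l => sq_nonneg _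
  have hmass : (k : ℝ) - ∑ j, w j = δ := by
    rw [hδ, hw, Finset.sum_comm, Finset.sum_sub_distrib]
    simp [transpose_mul_apply_self]
  have hcompress : ∑ j, ν j * w j ≤ ∑ i : Fin k, μ (Fin.castLE hkN i) + 2 * δ := by
    have hG : Tᵀ * diagonal ν * T = Tᵀ * T * diagonal μ * (Tᵀ * T) := by
      rw [← hcomp]
      simp only [Matrix.mul_assoc]
    have hidem : Tᵀ * T * (Tᵀ * T) = Tᵀ * T := by
      rw [Matrix.mul_assoc, ← Matrix.mul_assoc T, hT, Matrix.one_mul]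
    have hsymm : (Tᵀ * T)ᵀ = Tᵀ * T := by rw [transpose_mul, transpose_transpose]
    rw [hδ, Finset.mul_sum, ← Finset.sum_add_distrib]
    simp only [hw, Finset.mul_sum]
    rw [Finset.sum_comm]
    refine Finset.sum_le_sum fun i _ => ?_
    rw [← transpose_mul_diagonal_mul_apply_self, hG]
    exact sum_mul_projection_sq_le hsymm hidem hμ0 hμ2 _
  have hfan := sum_head_le_sum_weighted hk hν hν0
    (fun j => Finset.sum_nonneg fun i _ => sq_nonneg _) hw1 (by linarith)
  rw [hmass] at hfan
  linarith

/-- **Head eigenvalue gap bound.**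
For symmetric PSD `A` with largest eigenvalue at most `2`, `C Cᵀ = I_n`, and `U_k`
the first `k` columns of an orthogonal eigenbasis of `A` sorted by nondecreasing
eigenvalue, if `δ = ‖(I - CᵀC) U_k‖_F² < 1` then
`∑_{i≤k} (λ_c(i) - λ(i)) ≤ (δ(2 + ∑_{i≤k} λ(i)) + √(8δ ∑_{i≤k} λ(i)))/(1 - δ)`. -/
theorem head_eigenvalue_gap_bound {N n k : ℕ} (hk : k ≤ n) (hnN : n ≤ N)
    (A : Matrix (Fin N) (Fin N) ℝ) (hA : A.PosSemidef)
    (hmax : ∀ (σ : ℝ) (v : Fin N → ℝ), v ≠ 0 → A.mulVec v = σ • v → σ ≤ 2)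
    (C : Matrix (Fin n) (Fin N) ℝ) (hC : C * Cᵀ = 1)
    (μ : Fin N → ℝ) (U : Matrix (Fin N) (Fin N) ℝ)
    (hUorth : Uᵀ * U = 1) (hmono : Monotone μ)
    (hdecomp : A = U * Matrix.diagonal μ * Uᵀ)
    (δ : ℝ)
    (hδ : δ = frobSq ((1 - Cᵀ * C) * U.submatrix id (Fin.castLE (hk.trans hnN))))
    (hδ1 : δ < 1)
    (μc : Fin n → ℝ) (hμc : sortedEigs (C * A * Cᵀ) μc) :
    ∑ i : Fin k, (μc (Fin.castLE hk i) - μ (Fin.castLE (hk.trans hnN) i)) ≤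
      (δ * (2 + ∑ i : Fin k, μ (Fin.castLE (hk.trans hnN) i)) +
        Real.sqrt (8 * δ * ∑ i : Fin k, μ (Fin.castLE (hk.trans hnN) i))) / (1 - δ) := by
  have hUU : U * Uᵀ = 1 := mul_eq_one_comm.1 hUorth
  have hAU : A * U = U * diagonal μ := by
    rw [hdecomp, Matrix.mul_assoc, hUorth, Matrix.mul_one]
  have hAdiag : Uᵀ * A * U = diagonal μ := by
    rw [Matrix.mul_assoc, hAU, ← Matrix.mul_assoc, hUorth, Matrix.one_mul]
  have hμ0 : ∀ l, 0 ≤ μ l := by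
    have h := hA.conjTranspose_mul_mul_same U
    rw [conjTranspose_eq_transpose_of_trivial, hAdiag] at h
    exact posSemidef_diagonal_iff.1 h
  have hμ2 : ∀ l, μ l ≤ 2 := fun l => by
    refine hmax (μ l) (U.col l) (fun h => ?_) ?_
    · have h1 := transpose_mul_apply_self U l
      rw [hUorth, one_apply_eq] at h1
      have h2 : ∀ j, U j l = 0 := fun j => congrFun h j
      simp [h2] at h1
    · ext j
      have h := congrFun (congrFun hAU j) l
      rw [Matrix.mul_diagonal, Matrix.mul_apply] at h
      simpa [Matrix.mulVec, dotProduct, mul_comm] using h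
  have hB : (C * A * Cᵀ).IsHermitian := by
    have h := isHermitian_mul_mul_conjTranspose C hA.1
    rwa [conjTranspose_eq_transpose_of_trivial] at h
  obtain ⟨Q, hQ, hQB⟩ := exists_orthogonal_diagonalization hB hμc
  have hQQ : Q * Qᵀ = 1 := mul_eq_one_comm.1 hQ
  have hT : (Qᵀ * C * U) * (Qᵀ * C * U)ᵀ = 1 := by
    calc (Qᵀ * C * U) * (Qᵀ * C * U)ᵀ = Qᵀ * (C * (U * Uᵀ) * Cᵀ) * Q := by
          simp only [transpose_mul, transpose_transpose, Matrix.mul_assoc]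
      _ = 1 := by rw [hUU, Matrix.mul_one, hC, Matrix.mul_one, hQ]
  have hcomp : (Qᵀ * C * U) * diagonal μ * (Qᵀ * C * U)ᵀ = diagonal μc := by
    rw [← hQB, hdecomp]
    simp only [transpose_mul, transpose_transpose, Matrix.mul_assoc]
  have hTT : (Qᵀ * C * U)ᵀ * (Qᵀ * C * U) = Uᵀ * (Cᵀ * C) * U := by
    calc (Qᵀ * C * U)ᵀ * (Qᵀ * C * U) = Uᵀ * (Cᵀ * (Q * Qᵀ) * C) * U := by
          simp only [transpose_mul, transpose_transpose, Matrix.mul_assoc]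
      _ = _ := by rw [hQQ, Matrix.mul_one]
  have hproj : ((1 - Cᵀ * C) * U)ᵀ * ((1 - Cᵀ * C) * U) =
      1 - (Qᵀ * C * U)ᵀ * (Qᵀ * C * U) := by
    have hidem : (1 - Cᵀ * C)ᵀ * (1 - Cᵀ * C) = 1 - Cᵀ * C := by
      have h : Cᵀ * C * (Cᵀ * C) = Cᵀ * C := by
        rw [Matrix.mul_assoc, ← Matrix.mul_assoc C, hC, Matrix.one_mul]
      rw [transpose_sub, transpose_one, transpose_mul, transpose_transpose, Matrix.mul_sub,
        Matrix.mul_one, Matrix.sub_mul, Matrix.one_mul, h, sub_self, sub_zero]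
    rw [transpose_mul, Matrix.mul_assoc, ← Matrix.mul_assoc (1 - Cᵀ * C)ᵀ, hidem,
      Matrix.sub_mul, Matrix.one_mul, Matrix.mul_sub, hUorth, hTT, Matrix.mul_assoc Uᵀ]
  have hδ0 : 0 ≤ δ := by
    rw [hδ]
    exact Finset.sum_nonneg fun _ _ => Finset.sum_nonneg fun _ _ => sq_nonneg _
  have hδT : δ = ∑ i : Fin k, (1 - ((Qᵀ * C * U)ᵀ * (Qᵀ * C * U))
      (Fin.castLE (hk.trans hnN) i) (Fin.castLE (hk.trans hnN) i)) := by
    rw [hδ, frobSq, Finset.sum_comm]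
    refine Finset.sum_congr rfl fun i _ => ?_
    have h := congrFun (congrFun hproj (Fin.castLE (hk.trans hnN) i)) (Fin.castLE (hk.trans hnN) i)
    rw [transpose_mul_apply_self, Matrix.sub_apply, one_apply_eq] at h
    exact h
  have hmain := sum_head_compression_le hk (hk.trans hnN) hT hμ0 hμ2 hμc.1 hcomp hδ0 hδT
  rw [le_div_iff₀ (by linarith), Finset.sum_sub_distrib]
  linarith [Real.sqrt_nonneg (8 * δ * ∑ i : Fin k, μ (Fin.castLE (hk.trans hnN) i))]
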